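/- Let A be a commutative bigraded bidifferential algebra over ℂ. Let α, β, γ ∈ A be homogeneous of total degrees k₁, k₂, k₃ with ∂α = ∂̄α = 0, ∂β = ∂̄β = 0, ∂γ = ∂̄γ = 0, and x, y ∈ A homogeneous with αβ = i∂∂̄x and βγ = i∂∂̄y. Let w ∈ A be homogeneous of total degree k₁ − 2 and set α' = α + i∂∂̄w. Then: (1) ∂α' = 0 and ∂̄α' = 0; (2) α'β = i∂∂̄(x + wβ); (3) the difference (α'y − (x + wβ)γ) − (αy − xγ) lies in im ∂ + im ∂̄. In particular, the Aeppli–Bott–Chern–Massey representatives for (α', β, γ) and (α, β, γ) define the same class in the Aeppli cohomology H_A(A): the ABC-Massey product depends only on the Bott–Chern class of α. -/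

import Mathlib

/-- A commutative bigraded bidifferential algebra (cbba) over `ℂ`: an `(ℕ × ℕ)`-graded
associative unital `ℂ`-algebra `A = ⊕_{p,q} A^{p,q}`, graded-commutative with respect to the
total degree, with `ℂ`-linear maps `∂ : A^{p,q} → A^{p+1,q}` (here `D`) and
`∂̄ : A^{p,q} → A^{p,q+1}` (here `Dbar`) satisfying `∂² = 0`, `∂̄² = 0`, `∂∂̄ + ∂̄∂ = 0`, and
the graded Leibniz rules. -/
structure CBBA where
  A : Type
  [ringA : Ring A]
  [algA : Algebra ℂ A]
  /-- the bigrading `A^{p,q}` -/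
  gr : ℕ → ℕ → Submodule ℂ A
  /-- `A` is the internal direct sum of the `A^{p,q}` -/
  internal : DirectSum.IsInternal (fun pq : ℕ × ℕ => gr pq.1 pq.2)
  one_mem : (1 : A) ∈ gr 0 0
  mul_mem : ∀ {p q p' q' : ℕ} {a b : A}, a ∈ gr p q → b ∈ gr p' q' →
      a * b ∈ gr (p + p') (q + q')
  /-- graded commutativity with respect to the total degree -/
  comm : ∀ {p q p' q' : ℕ} {a b : A}, a ∈ gr p q → b ∈ gr p' q' →
      a * b = ((-1 : ℂ) ^ ((p + q) * (p' + q'))) • (b * a)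
  /-- the operator `∂` -/
  D : A →ₗ[ℂ] A
  /-- the operator `∂̄` -/
  Dbar : A →ₗ[ℂ] A
  D_mem : ∀ {p q : ℕ} {a : A}, a ∈ gr p q → D a ∈ gr (p + 1) q
  Dbar_mem : ∀ {p q : ℕ} {a : A}, a ∈ gr p q → Dbar a ∈ gr p (q + 1)
  D_sq : ∀ a : A, D (D a) = 0
  Dbar_sq : ∀ a : A, Dbar (Dbar a) = 0
  anticomm : ∀ a : A, D (Dbar a) + Dbar (D a) = 0
  leibniz_D : ∀ {p q : ℕ} {a : A}, a ∈ gr p q → ∀ b : A,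
      D (a * b) = D a * b + ((-1 : ℂ) ^ (p + q)) • (a * D b)
  leibniz_Dbar : ∀ {p q : ℕ} {a : A}, a ∈ gr p q → ∀ b : A,
      Dbar (a * b) = Dbar a * b + ((-1 : ℂ) ^ (p + q)) • (a * Dbar b)

attribute [instance] CBBA.ringA CBBA.algA

/-- An element of a cbba is homogeneous of total degree `k` if it lies in
`A^k = ⊕_{p+q=k} A^{p,q}`. -/
def CBBA.Homog (C : CBBA) (a : C.A) (k : ℕ) : Prop :=
  a ∈ ⨆ (p : ℕ) (q : ℕ) (_ : p + q = k), C.gr p q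

namespace CBBA

variable {C : CBBA}

theorem Homog.induction {k : ℕ} {P : C.A → Prop}
    (mem : ∀ {p q : ℕ} {a : C.A}, p + q = k → a ∈ C.gr p q → P a) (zero : P 0)
    (add : ∀ a b : C.A, P a → P b → P (a + b)) {a : C.A} (ha : C.Homog a k) : P a := by
  refine Submodule.iSup_induction _ (motive := P) ha (fun p a ha => ?_) zero add
  refine Submodule.iSup_induction _ (motive := P) ha (fun q a ha => ?_) zero add
  exact Submodule.iSup_induction _ (motive := P) ha (fun h a ha => mem h ha) zero add

theorem homog_of_mem_gr {p q : ℕ} {a : C.A} (ha : a ∈ C.gr p q) : C.Homog a (p + q) :=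
  Submodule.mem_iSup_of_mem p <| Submodule.mem_iSup_of_mem q <| Submodule.mem_iSup_of_mem rfl ha

theorem Homog.Dbar {k : ℕ} {a : C.A} (ha : C.Homog a k) : C.Homog (C.Dbar a) (k + 1) := by
  refine ha.induction (P := fun a => C.Homog (C.Dbar a) (k + 1)) ?_ ?_ ?_
  · rintro p q a rfl ha
    rw [add_assoc]
    exact homog_of_mem_gr (C.Dbar_mem ha)
  · rw [map_zero]
    exact Submodule.zero_mem _
  · intro a b ha hb
    rw [map_add]
    exact Submodule.add_mem _ ha hb

theorem Homog.leibniz_D {k : ℕ} {a : C.A} (ha : C.Homog a k) (b : C.A) :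
    C.D (a * b) = C.D a * b + ((-1 : ℂ) ^ k) • (a * C.D b) := by
  refine ha.induction (P := fun a => C.D (a * b) = C.D a * b + ((-1 : ℂ) ^ k) • (a * C.D b))
    ?_ ?_ ?_
  · rintro p q a rfl ha
    exact C.leibniz_D ha b
  · simp
  · intro a a' ha ha'
    simp only [add_mul, map_add, smul_add, ha, ha']
    abel

theorem Homog.leibniz_Dbar {k : ℕ} {a : C.A} (ha : C.Homog a k) (b : C.A) :
    C.Dbar (a * b) = C.Dbar a * b + ((-1 : ℂ) ^ k) • (a * C.Dbar b) := by
  refine ha.induction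
    (P := fun a => C.Dbar (a * b) = C.Dbar a * b + ((-1 : ℂ) ^ k) • (a * C.Dbar b)) ?_ ?_ ?_
  · rintro p q a rfl ha
    exact C.leibniz_Dbar ha b
  · simp
  · intro a a' ha ha'
    simp only [add_mul, map_add, smul_add, ha, ha']
    abel

theorem Dbar_D (a : C.A) : C.Dbar (C.D a) = -C.D (C.Dbar a) :=
  eq_neg_of_add_eq_zero_right (C.anticomm a)

/-- Right multiplication by a closed element commutes with `∂∂̄`. -/
theorem Homog.D_Dbar_mul_of_closed {k : ℕ} {w b : C.A} (hw : C.Homog w k)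
    (hbD : C.D b = 0) (hbDb : C.Dbar b = 0) :
    C.D (C.Dbar (w * b)) = C.D (C.Dbar w) * b := by
  rw [hw.leibniz_Dbar, hbDb, mul_zero, smul_zero, add_zero, hw.Dbar.leibniz_D, hbD, mul_zero,
    smul_zero, add_zero]

/-- Green's identity: `∂∂̄` can be moved across a product modulo `im ∂ + im ∂̄`. -/
theorem Homog.D_Dbar_mul_sub_mul_D_Dbar {k : ℕ} {w : C.A} (hw : C.Homog w k) (y : C.A) :
    C.D (C.Dbar w) * y - w * C.D (C.Dbar y) =
      C.D (C.Dbar w * y) + C.Dbar (((-1 : ℂ) ^ k) • (w * C.D y)) := by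
  have hs : ((-1 : ℂ) ^ k) * (-1) ^ k = 1 := by rw [← mul_pow]; simp
  rw [map_smul, hw.Dbar.leibniz_D, hw.leibniz_Dbar, Dbar_D, smul_add, smul_smul, hs, pow_succ,
    mul_neg, mul_neg, mul_one, neg_smul, one_smul]
  abel

end CBBA

/-- Changing the Bott–Chern representative `α` to `α' = α + i∂∂̄w`
(with `w` homogeneous of total degree `k₁ − 2`): (1) `α'` is again `∂`- and `∂̄`-closed;
(2) `α'β = i∂∂̄(x + wβ)`; (3) the difference of the two Aeppli–Bott–Chern–Massey
representatives `(α'y − (x + wβ)γ) − (αy − xγ)` lies in `im ∂ + im ∂̄`, hence they define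
the same Aeppli cohomology class: the ABC-Massey product depends only on the Bott–Chern
class of `α`. -/
theorem abc_massey_independent_of_BC_representative_left (C : CBBA)
    (k₁ k₂ k₃ l₁ l₂ : ℕ) (α β γ x y w : C.A)
    (hα : C.Homog α k₁) (hβ : C.Homog β k₂) (hγ : C.Homog γ k₃)
    (hx : C.Homog x l₁) (hy : C.Homog y l₂) (hw : C.Homog w (k₁ - 2))
    (hαD : C.D α = 0) (hαDb : C.Dbar α = 0)
    (hβD : C.D β = 0) (hβDb : C.Dbar β = 0)
    (hγD : C.D γ = 0) (hγDb : C.Dbar γ = 0)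
    (hxab : α * β = Complex.I • C.D (C.Dbar x))
    (hybc : β * γ = Complex.I • C.D (C.Dbar y)) :
    (C.D (α + Complex.I • C.D (C.Dbar w)) = 0 ∧
     C.Dbar (α + Complex.I • C.D (C.Dbar w)) = 0) ∧
    (α + Complex.I • C.D (C.Dbar w)) * β = Complex.I • C.D (C.Dbar (x + w * β)) ∧
    ((α + Complex.I • C.D (C.Dbar w)) * y - (x + w * β) * γ) - (α * y - x * γ)
      ∈ LinearMap.range C.D ⊔ LinearMap.range C.Dbar := by
  have hDDb : C.Dbar (C.D (C.Dbar w)) = 0 := by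
    rw [CBBA.Dbar_D, C.Dbar_sq, map_zero, neg_zero]
  refine ⟨⟨?_, ?_⟩, ?_, ?_⟩
  · rw [map_add, map_smul, hαD, C.D_sq, smul_zero, add_zero]
  · rw [map_add, map_smul, hαDb, hDDb, smul_zero, add_zero]
  · rw [add_mul, hxab, map_add, map_add, smul_add, hw.D_Dbar_mul_of_closed hβD hβDb,
      smul_mul_assoc]
  · have key : ((α + Complex.I • C.D (C.Dbar w)) * y - (x + w * β) * γ) - (α * y - x * γ)
        = Complex.I • (C.D (C.Dbar w) * y - w * C.D (C.Dbar y)) := by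
      rw [add_mul, add_mul, mul_assoc w, hybc, smul_mul_assoc, mul_smul_comm, smul_sub]
      abel
    rw [key, hw.D_Dbar_mul_sub_mul_D_Dbar]
    exact Submodule.smul_mem _ _ (Submodule.add_mem_sup ⟨_, rfl⟩ ⟨_, rfl⟩)
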